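/- arXiv:1911.09144 — 3 statements merged into one kernel-verified Lean document; each statement's English description precedes it below -/
import Mathlib

section
/- Let ψ¹, ψ², ψ³ ∈ ℍ be real quaternions and write ψ̄ = {ψ̄¹, ψ̄², ψ̄³}. The following are equivalent: (a) for every twice continuously differentiable function f : ℝ³ → ℍ(ℂ) one has ψD[ψ̄D[f]] = Δf and ψ̄D[ψD[f]] = Δf, where Δ is the Laplacian acting componentwise; (b) ψʲψ̄ᵏ + ψᵏψ̄ʲ = 2δ_{jk} for all j, k ∈ {1, 2, 3}. -/
noncomputable section

/-- `ℝ³` as Euclidean space. -/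
abbrev E3 : Type := EuclideanSpace ℝ (Fin 3)

/-- Embedding of the real quaternions into the complex quaternions. -/
def toQC (a : Quaternion ℝ) : Quaternion ℂ :=
  ⟨(a.re : ℂ), (a.imI : ℂ), (a.imJ : ℂ), (a.imK : ℂ)⟩

/-- Partial derivative `∂g/∂xₖ` of a complex-valued function on `ℝ³`. -/
def pdC (k : Fin 3) (g : E3 → ℂ) (x : E3) : ℂ :=
  fderiv ℝ g x (EuclideanSpace.single k 1)

/-- Componentwise partial derivative `∂f/∂xₖ` of a complex-quaternion-valued function. -/
def pdQ (k : Fin 3) (f : E3 → Quaternion ℂ) (x : E3) : Quaternion ℂ :=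
  ⟨pdC k (fun y => (f y).re) x, pdC k (fun y => (f y).imI) x,
   pdC k (fun y => (f y).imJ) x, pdC k (fun y => (f y).imK) x⟩

/-- The left operator `ψD[f] = Σₖ ψᵏ ∂f/∂xₖ` associated to a triple `ψ` of real quaternions. -/
def DL (ψ : Fin 3 → Quaternion ℝ) (f : E3 → Quaternion ℂ) (x : E3) : Quaternion ℂ :=
  ∑ k : Fin 3, toQC (ψ k) * pdQ k f x

/-- `f : ℝ³ → ℍ(ℂ)` is `n` times continuously differentiable (componentwise). -/
def QCContDiff (n : ℕ) (f : E3 → Quaternion ℂ) : Prop :=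
  ContDiff ℝ n (fun x => (f x).re) ∧ ContDiff ℝ n (fun x => (f x).imI) ∧
  ContDiff ℝ n (fun x => (f x).imJ) ∧ ContDiff ℝ n (fun x => (f x).imK)

/-- The Laplacian `Δf = Σₖ ∂²f/∂xₖ²`, acting componentwise. -/
def lapQ (f : E3 → Quaternion ℂ) (x : E3) : Quaternion ℂ :=
  ∑ k : Fin 3, pdQ k (pdQ k f) x

@[simp] theorem re_toQC (a : Quaternion ℝ) : (toQC a).re = a.re := rfl
@[simp] theorem imI_toQC (a : Quaternion ℝ) : (toQC a).imI = a.imI := rfl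
@[simp] theorem imJ_toQC (a : Quaternion ℝ) : (toQC a).imJ = a.imJ := rfl
@[simp] theorem imK_toQC (a : Quaternion ℝ) : (toQC a).imK = a.imK := rfl

theorem re_pdQ (k : Fin 3) (f : E3 → Quaternion ℂ) (x : E3) :
    (pdQ k f x).re = pdC k (fun y => (f y).re) x := rfl
theorem imI_pdQ (k : Fin 3) (f : E3 → Quaternion ℂ) (x : E3) :
    (pdQ k f x).imI = pdC k (fun y => (f y).imI) x := rfl
theorem imJ_pdQ (k : Fin 3) (f : E3 → Quaternion ℂ) (x : E3) :
    (pdQ k f x).imJ = pdC k (fun y => (f y).imJ) x := rfl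
theorem imK_pdQ (k : Fin 3) (f : E3 → Quaternion ℂ) (x : E3) :
    (pdQ k f x).imK = pdC k (fun y => (f y).imK) x := rfl

theorem toQC_add (a b : Quaternion ℝ) : toQC (a + b) = toQC a + toQC b := by
  ext <;> simp

theorem toQC_mul (a b : Quaternion ℝ) : toQC (a * b) = toQC a * toQC b := by
  ext <;> simp

theorem toQC_injective : Function.Injective toQC := by
  intro a b h
  rw [Quaternion.ext_iff] at h ⊢
  simpa using h

/-- Real differentiability of the four complex components at a point. -/
def QCDiffAt (f : E3 → Quaternion ℂ) (x : E3) : Prop :=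
  DifferentiableAt ℝ (fun y => (f y).re) x ∧ DifferentiableAt ℝ (fun y => (f y).imI) x ∧
  DifferentiableAt ℝ (fun y => (f y).imJ) x ∧ DifferentiableAt ℝ (fun y => (f y).imK) x

theorem pdC_add (k : Fin 3) {g h : E3 → ℂ} {x : E3} (hg : DifferentiableAt ℝ g x)
    (hh : DifferentiableAt ℝ h x) : pdC k (fun y => g y + h y) x = pdC k g x + pdC k h x := by
  simp [pdC, fderiv_fun_add hg hh]

theorem pdC_sub (k : Fin 3) {g h : E3 → ℂ} {x : E3} (hg : DifferentiableAt ℝ g x)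
    (hh : DifferentiableAt ℝ h x) : pdC k (fun y => g y - h y) x = pdC k g x - pdC k h x := by
  simp [pdC, fderiv_fun_sub hg hh]

theorem pdC_const_mul (k : Fin 3) (c : ℂ) {g : E3 → ℂ} {x : E3} (hg : DifferentiableAt ℝ g x) :
    pdC k (fun y => c * g y) x = c * pdC k g x := by
  simp [pdC, fderiv_const_mul hg]

theorem QCDiffAt.add {f g : E3 → Quaternion ℂ} {x : E3} (hf : QCDiffAt f x) (hg : QCDiffAt g x) :
    QCDiffAt (fun y => f y + g y) x := by
  obtain ⟨h1, h2, h3, h4⟩ := hf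
  obtain ⟨g1, g2, g3, g4⟩ := hg
  exact ⟨h1.add g1, h2.add g2, h3.add g3, h4.add g4⟩

theorem QCDiffAt.const_mul (q : Quaternion ℂ) {f : E3 → Quaternion ℂ} {x : E3}
    (hf : QCDiffAt f x) : QCDiffAt (fun y => q * f y) x := by
  obtain ⟨h1, h2, h3, h4⟩ := hf
  refine ⟨?_, ?_, ?_, ?_⟩ <;>
    simp only [Quaternion.re_mul, Quaternion.imI_mul, Quaternion.imJ_mul, Quaternion.imK_mul] <;>
    fun_prop

theorem pdQ_add (k : Fin 3) {f g : E3 → Quaternion ℂ} {x : E3} (hf : QCDiffAt f x)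
    (hg : QCDiffAt g x) : pdQ k (fun y => f y + g y) x = pdQ k f x + pdQ k g x := by
  obtain ⟨h1, h2, h3, h4⟩ := hf
  obtain ⟨g1, g2, g3, g4⟩ := hg
  ext
  · exact pdC_add k h1 g1
  · exact pdC_add k h2 g2
  · exact pdC_add k h3 g3
  · exact pdC_add k h4 g4

theorem pdQ_const_mul (k : Fin 3) (q : Quaternion ℂ) {f : E3 → Quaternion ℂ} {x : E3}
    (hf : QCDiffAt f x) : pdQ k (fun y => q * f y) x = q * pdQ k f x := by
  obtain ⟨h1, h2, h3, h4⟩ := hf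
  have m (c : ℂ) {g : E3 → ℂ} (hg : DifferentiableAt ℝ g x) :
      DifferentiableAt ℝ (fun y => c * g y) x := hg.const_mul c
  ext
  · simp only [re_pdQ, imI_pdQ, imJ_pdQ, imK_pdQ, Quaternion.re_mul]
    rw [pdC_sub k (((m _ h1).fun_sub (m _ h2)).fun_sub (m _ h3)) (m _ h4),
      pdC_sub k ((m _ h1).fun_sub (m _ h2)) (m _ h3), pdC_sub k (m _ h1) (m _ h2),
      pdC_const_mul k _ h1, pdC_const_mul k _ h2, pdC_const_mul k _ h3, pdC_const_mul k _ h4]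
  · simp only [re_pdQ, imI_pdQ, imJ_pdQ, imK_pdQ, Quaternion.imI_mul]
    rw [pdC_sub k (((m _ h2).fun_add (m _ h1)).fun_add (m _ h4)) (m _ h3),
      pdC_add k ((m _ h2).fun_add (m _ h1)) (m _ h4), pdC_add k (m _ h2) (m _ h1),
      pdC_const_mul k _ h1, pdC_const_mul k _ h2, pdC_const_mul k _ h3, pdC_const_mul k _ h4]
  · simp only [re_pdQ, imI_pdQ, imJ_pdQ, imK_pdQ, Quaternion.imJ_mul]
    rw [pdC_add k (((m _ h3).fun_sub (m _ h4)).fun_add (m _ h1)) (m _ h2),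
      pdC_add k ((m _ h3).fun_sub (m _ h4)) (m _ h1), pdC_sub k (m _ h3) (m _ h4),
      pdC_const_mul k _ h1, pdC_const_mul k _ h2, pdC_const_mul k _ h3, pdC_const_mul k _ h4]
  · simp only [re_pdQ, imI_pdQ, imJ_pdQ, imK_pdQ, Quaternion.imK_mul]
    rw [pdC_add k (((m _ h4).fun_add (m _ h3)).fun_sub (m _ h2)) (m _ h1),
      pdC_sub k ((m _ h4).fun_add (m _ h3)) (m _ h2), pdC_add k (m _ h4) (m _ h3),
      pdC_const_mul k _ h1, pdC_const_mul k _ h2, pdC_const_mul k _ h3, pdC_const_mul k _ h4]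

theorem differentiable_fderiv_of_contDiff_two {g : E3 → ℂ} (hg : ContDiff ℝ (2 : ℕ) g) :
    Differentiable ℝ (fderiv ℝ g) :=
  (hg.fderiv_right (m := 1) (by norm_num)).differentiable one_ne_zero

theorem differentiable_pdC (k : Fin 3) {g : E3 → ℂ} (hg : ContDiff ℝ (2 : ℕ) g) :
    Differentiable ℝ (pdC k g) :=
  (differentiable_fderiv_of_contDiff_two hg).clm_apply (differentiable_const _)

theorem pdC_comm (j k : Fin 3) {g : E3 → ℂ} (hg : ContDiff ℝ (2 : ℕ) g) (x : E3) :
    pdC j (pdC k g) x = pdC k (pdC j g) x := by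
  have key (a b : Fin 3) : pdC a (pdC b g) x =
      fderiv ℝ (fderiv ℝ g) x (EuclideanSpace.single a 1) (EuclideanSpace.single b 1) := by
    unfold pdC
    rw [fderiv_clm_apply (differentiable_fderiv_of_contDiff_two hg x)
      (differentiableAt_const _)]
    simp
  rw [key, key]
  exact (hg.contDiffAt.isSymmSndFDerivAt (by simp)) _ _

theorem QCContDiff.qcDiffAt_pdQ {f : E3 → Quaternion ℂ} (hf : QCContDiff 2 f) (k : Fin 3)
    (x : E3) : QCDiffAt (pdQ k f) x := by
  obtain ⟨h1, h2, h3, h4⟩ := hf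
  exact ⟨differentiable_pdC k h1 x, differentiable_pdC k h2 x, differentiable_pdC k h3 x,
    differentiable_pdC k h4 x⟩

theorem pdQ_comm {f : E3 → Quaternion ℂ} (hf : QCContDiff 2 f) (j k : Fin 3) (x : E3) :
    pdQ j (pdQ k f) x = pdQ k (pdQ j f) x := by
  obtain ⟨h1, h2, h3, h4⟩ := hf
  ext
  · exact pdC_comm j k h1 x
  · exact pdC_comm j k h2 x
  · exact pdC_comm j k h3 x
  · exact pdC_comm j k h4 x

theorem pdQ_DL (φ : Fin 3 → Quaternion ℝ) {f : E3 → Quaternion ℂ} (hf : QCContDiff 2 f)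
    (k : Fin 3) (x : E3) :
    pdQ k (DL φ f) x = ∑ j : Fin 3, toQC (φ j) * pdQ k (pdQ j f) x := by
  have e : DL φ f = fun y =>
      toQC (φ 0) * pdQ 0 f y + toQC (φ 1) * pdQ 1 f y + toQC (φ 2) * pdQ 2 f y := by
    funext y
    simp [DL, Fin.sum_univ_three]
  have d (j : Fin 3) := hf.qcDiffAt_pdQ j x
  have c (j : Fin 3) := (d j).const_mul (toQC (φ j))
  rw [e, pdQ_add k ((c 0).add (c 1)) (c 2), pdQ_add k (c 0) (c 1), pdQ_const_mul k _ (d 0),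
    pdQ_const_mul k _ (d 1), pdQ_const_mul k _ (d 2), Fin.sum_univ_three]

theorem DL_DL (ψ φ : Fin 3 → Quaternion ℝ) {f : E3 → Quaternion ℂ} (hf : QCContDiff 2 f)
    (x : E3) :
    DL ψ (DL φ f) x = ∑ k : Fin 3, ∑ j : Fin 3, toQC (ψ k * φ j) * pdQ k (pdQ j f) x := by
  simp only [DL.eq_1 ψ, pdQ_DL φ hf, Finset.mul_sum, toQC_mul, mul_assoc]

theorem toQC_ite_two (p : Prop) [Decidable p] :
    toQC (if p then 2 else 0) = if p then 2 else 0 := by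
  split_ifs
  · rw [← one_add_one_eq_two, ← one_add_one_eq_two, toQC_add]
    congr 1
  · ext <;> exact Complex.ofReal_zero

theorem eq_of_add_self_eq_add_self {a b : Quaternion ℂ} (h : a + a = b + b) : a = b := by
  rw [Quaternion.ext_iff] at h ⊢
  simp only [Quaternion.re_add, Quaternion.imI_add, Quaternion.imJ_add, Quaternion.imK_add] at h
  simpa [← two_mul] using h

theorem DL_DL_eq_lapQ {ψ φ : Fin 3 → Quaternion ℝ}
    (h : ∀ j k : Fin 3, ψ j * φ k + ψ k * φ j = if j = k then 2 else 0)
    {f : E3 → Quaternion ℂ} (hf : QCContDiff 2 f) (x : E3) :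
    DL ψ (DL φ f) x = lapQ f x := by
  have symm : DL ψ (DL φ f) x =
      ∑ k : Fin 3, ∑ j : Fin 3, toQC (ψ j * φ k) * pdQ k (pdQ j f) x := by
    rw [DL_DL ψ φ hf, Finset.sum_comm]
    simp only [fun j k => pdQ_comm hf j k x]
  apply eq_of_add_self_eq_add_self
  nth_rewrite 1 [DL_DL ψ φ hf]
  rw [symm]
  simp only [← Finset.sum_add_distrib, ← add_mul, ← toQC_add, h, toQC_ite_two, ite_mul,
    zero_mul, Finset.sum_ite_eq, Finset.mem_univ, if_true, lapQ, two_mul]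

/-- The `j`-th coordinate on `ℝ³` as a complex-valued real-linear functional. -/
def coordC (j : Fin 3) : E3 →L[ℝ] ℂ :=
  Complex.ofRealCLM.comp (EuclideanSpace.proj j)

theorem coordC_single (j k : Fin 3) :
    coordC j (EuclideanSpace.single k 1) = if j = k then 1 else 0 := by
  simp [coordC, apply_ite]

theorem pdC_coordC_mul (a j k : Fin 3) :
    pdC a (fun x => coordC j x * coordC k x) = fun x =>
      (if k = a then 1 else 0) * coordC j x + (if j = a then 1 else 0) * coordC k x := by
  funext x
  rw [pdC, fderiv_fun_mul (coordC j).differentiableAt (coordC k).differentiableAt]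
  simp [coordC_single]

theorem pdC_pdC_coordC_mul (b a j k : Fin 3) (x : E3) :
    pdC b (pdC a (fun x => coordC j x * coordC k x)) x =
      (if k = a then 1 else 0) * (if j = b then 1 else 0) +
      (if j = a then 1 else 0) * (if k = b then 1 else 0) := by
  have p (l : Fin 3) : pdC b (fun y => coordC l y) x = if l = b then 1 else 0 := by
    rw [pdC, (coordC l).fderiv, coordC_single]
  rw [pdC_coordC_mul, pdC_add b ((coordC j).differentiableAt.const_mul _)
    ((coordC k).differentiableAt.const_mul _), pdC_const_mul b _ (coordC j).differentiableAt,
    pdC_const_mul b _ (coordC k).differentiableAt, p, p]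

/-- The scalar quadratic monomial `xⱼ xₖ` as a complex-quaternion-valued function. -/
def quadMonomial (j k : Fin 3) (x : E3) : Quaternion ℂ :=
  ⟨coordC j x * coordC k x, 0, 0, 0⟩

theorem qcContDiff_quadMonomial (j k : Fin 3) : QCContDiff 2 (quadMonomial j k) :=
  ⟨(coordC j).contDiff.mul (coordC k).contDiff, contDiff_const, contDiff_const, contDiff_const⟩

theorem pdQ_pdQ_quadMonomial (b a j k : Fin 3) (x : E3) :
    pdQ b (pdQ a (quadMonomial j k)) x =
      (if k = a then 1 else 0) * (if j = b then 1 else 0) +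
      (if j = a then 1 else 0) * (if k = b then 1 else 0) := by
  have z (c : Fin 3) : pdC c (fun _ => (0 : ℂ)) = fun _ => 0 := by
    funext y
    simp [pdC]
  have scalar : ((if k = a then 1 else 0) * (if j = b then 1 else 0) +
      (if j = a then 1 else 0) * (if k = b then 1 else 0) : Quaternion ℂ) =
      ((pdC b (pdC a (fun x => coordC j x * coordC k x)) x : ℂ) : Quaternion ℂ) := by
    rw [pdC_pdC_coordC_mul]
    split_ifs <;> simp
  rw [scalar]
  ext
  · rfl
  all_goals
    simp only [pdQ, quadMonomial, z]
    rfl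

theorem mul_add_mul_eq_of_DL_DL_eq_lapQ {ψ φ : Fin 3 → Quaternion ℝ}
    (h : ∀ f : E3 → Quaternion ℂ, QCContDiff 2 f → ∀ x : E3, DL ψ (DL φ f) x = lapQ f x)
    (j k : Fin 3) : ψ j * φ k + ψ k * φ j = if j = k then 2 else 0 := by
  apply toQC_injective
  have e := h _ (qcContDiff_quadMonomial j k) 0
  rw [DL_DL ψ φ (qcContDiff_quadMonomial j k)] at e
  simp only [lapQ, pdQ_pdQ_quadMonomial, mul_add, Finset.sum_add_distrib, mul_ite, mul_one,
    mul_zero, Finset.sum_ite_irrel, Finset.sum_const_zero, Finset.sum_ite_eq, Finset.mem_univ,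
    if_true] at e
  rw [toQC_add, toQC_ite_two, e]
  by_cases hjk : j = k
  · simp only [hjk, if_true, one_add_one_eq_two]
  · simp [hjk, Ne.symm hjk]

theorem mul_star_add_mul_star (a b : Quaternion ℝ) :
    a * star b + b * star a = star a * b + star b * a := by
  ext <;> simp <;> ring

/-- for real quaternions `ψ¹, ψ², ψ³`, the factorization
`ψD ψ̄D = ψ̄D ψD = Δ` on all `C²` functions `f : ℝ³ → ℍ(ℂ)` holds if and only if
`ψʲ ψ̄ᵏ + ψᵏ ψ̄ʲ = 2 δ_{jk}` for all `j, k`. -/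
theorem stmt1 (ψ : Fin 3 → Quaternion ℝ) :
    (∀ f : E3 → Quaternion ℂ, QCContDiff 2 f →
      (∀ x : E3, DL ψ (DL (fun k => star (ψ k)) f) x = lapQ f x) ∧
      (∀ x : E3, DL (fun k => star (ψ k)) (DL ψ f) x = lapQ f x)) ↔
    (∀ j k : Fin 3, ψ j * star (ψ k) + ψ k * star (ψ j) = if j = k then 2 else 0) := by
  refine ⟨fun h => mul_add_mul_eq_of_DL_DL_eq_lapQ fun f hf => (h f hf).1, fun h f hf =>
    ⟨DL_DL_eq_lapQ h hf, DL_DL_eq_lapQ (fun j k => ?_) hf⟩⟩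
  rw [← mul_star_add_mul_star, h]

end
end

section
/- Let θ ∈ [0, 2π], let Ω ⊂ ℝ³ be open, and let f = f₁𝐢 + f₂𝐣 + f₃𝐤 be a C¹ vector field on Ω with values in ℍ(ℂ) (i.e. with zero scalar part). Then ψ^θD[f] = 0 on Ω if and only if D^{ψ^θ}[f] = 0 on Ω; that is, a purely vectorial C¹ function is left-ψ^θ-hyperholomorphic if and only if it is right-ψ^θ-hyperholomorphic. -/
noncomputable section

/-- The structural set `ψ^θ = {𝐢, 𝐢e^{𝐢θ}𝐣, e^{𝐢θ}𝐣}`: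
`ψ¹ = 𝐢`, `ψ² = -sin θ·𝐣 + cos θ·𝐤`, `ψ³ = cos θ·𝐣 + sin θ·𝐤`. -/
def psiTheta (θ : ℝ) : Fin 3 → Quaternion ℝ :=
  ![⟨0, 1, 0, 0⟩, ⟨0, 0, -Real.sin θ, Real.cos θ⟩, ⟨0, 0, Real.cos θ, Real.sin θ⟩]

/-- The right operator `D^{ψ^θ}[f] = Σₖ (∂f/∂xₖ) ψᵏ`. -/
def DR (ψ : Fin 3 → Quaternion ℝ) (f : E3 → Quaternion ℂ) (x : E3) : Quaternion ℂ :=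
  ∑ k : Fin 3, pdQ k f x * toQC (ψ k)

theorem star_toQC_of_re_eq_zero {a : Quaternion ℝ} (ha : a.re = 0) :
    star (toQC a) = -toQC a :=
  Quaternion.star_eq_neg.2 (by rw [toQC, ha, Complex.ofReal_zero])

theorem psiTheta_re (θ : ℝ) (k : Fin 3) : (psiTheta θ k).re = 0 := by
  fin_cases k <;> rfl

theorem star_pdQ_of_re_eq_zero {f : E3 → Quaternion ℂ} (hf : ∀ y, (f y).re = 0)
    (k : Fin 3) (x : E3) : star (pdQ k f x) = -pdQ k f x := by
  refine Quaternion.star_eq_neg.2 ?_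
  change pdC k (fun y => (f y).re) x = 0
  simp [pdC, hf]

theorem Quaternion.star_mul_of_star_eq_neg {R : Type*} [CommRing R] {a b : Quaternion R}
    (ha : star a = -a) (hb : star b = -b) : star (a * b) = b * a := by
  rw [star_mul, ha, hb, neg_mul_neg]

/-- Quaternionic conjugation exchanges the left and right operators on vector fields. -/
theorem star_DL {ψ : Fin 3 → Quaternion ℝ} (hψ : ∀ k, (ψ k).re = 0)
    {f : E3 → Quaternion ℂ} (hf : ∀ y, (f y).re = 0) (x : E3) :
    star (DL ψ f x) = DR ψ f x := by
  refine (star_sum (R := Quaternion ℂ) _ _).trans (Finset.sum_congr rfl fun k _ => ?_)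
  exact Quaternion.star_mul_of_star_eq_neg (star_toQC_of_re_eq_zero (hψ k))
    (star_pdQ_of_re_eq_zero hf k x)

/-- for `θ ∈ [0, 2π]`, `Ω ⊂ ℝ³` open and a `C¹` vector field
`f = f₁𝐢 + f₂𝐣 + f₃𝐤` (zero scalar part) with values in `ℍ(ℂ)`, one has
`ψ^θD[f] = 0` on `Ω` iff `D^{ψ^θ}[f] = 0` on `Ω`. -/
theorem stmt4 (θ : ℝ) (hθ : θ ∈ Set.Icc (0 : ℝ) (2 * Real.pi))
    (Ω : Set E3) (hΩ : IsOpen Ω) (f₁ f₂ f₃ : E3 → ℂ)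
    (h1 : ContDiffOn ℝ 1 f₁ Ω) (h2 : ContDiffOn ℝ 1 f₂ Ω) (h3 : ContDiffOn ℝ 1 f₃ Ω) :
    (∀ x ∈ Ω, DL (psiTheta θ) (fun y => (⟨0, f₁ y, f₂ y, f₃ y⟩ : Quaternion ℂ)) x = 0) ↔
    (∀ x ∈ Ω, DR (psiTheta θ) (fun y => (⟨0, f₁ y, f₂ y, f₃ y⟩ : Quaternion ℂ)) x = 0) := by
  refine forall₂_congr fun x _ => ?_
  exact star_eq_zero.symm.trans
    (Eq.congr_left (star_DL (psiTheta_re θ) (fun _ => rfl) x))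

end
end

section
/- Let Ω ⊂ ℝ³ be a bounded open set with boundary Γ = ∂Ω, let 0 < μ ≤ 1, and let f : Γ → ℍ be Hölder continuous with exponent μ. Then there exist a function F : ℝ³ → ℍ and constants c, M > 0 such that: (a) F = f on Γ, F = 0 on ℝ³ ∖ (Ω ∪ Γ), and |F(x) − F(y)| ≤ M|x − y|^μ for all x, y ∈ Ω ∪ Γ; (b) F is differentiable at every x ∉ Γ and |∂F/∂xᵢ(x)| ≤ c · dist(x, Γ)^{μ−1} for all x ∉ Γ and i = 1, 2, 3. -/
open MeasureTheory Metric Set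
open scoped Topology NNReal

section WhitneyAverage

lemma infDist_lt_four_mul_dist {X : Type*} [PseudoMetricSpace X] {Γ : Set X} {x₀ x y : X}
    (hx : dist x x₀ ≤ infDist x₀ Γ / 16) (h0 : 0 < infDist x₀ Γ)
    (hy : y ∉ closedBall x₀ (infDist x₀ Γ / 2)) :
    infDist y Γ < 4 * dist x y := by
  have h1 := infDist_le_infDist_add_dist (s := Γ) (x := y) (y := x)
  have h2 := infDist_le_infDist_add_dist (s := Γ) (x := x) (y := x₀)
  have h3 := dist_triangle y x x₀
  rw [mem_closedBall, not_le] at hy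
  rw [dist_comm y x] at h1 h3
  linarith

variable {E : Type*} [NormedAddCommGroup E] [InnerProductSpace ℝ E] [FiniteDimensional ℝ E]

/-- A smooth bump function at the origin, equal to `1` on the ball of radius `1 / 8` and supported
in the ball of radius `1 / 4`. -/
noncomputable def whitneyBump (E : Type*) [NormedAddCommGroup E] : ContDiffBump (0 : E) :=
  ⟨1 / 8, 1 / 4, by norm_num, by norm_num⟩

/-- A kernel that is smooth in `x` and, as a function of `y`, localizes near `x` at the scale of
the distance from `x` to `Γ`. -/
noncomputable def whitneyKernel (Γ : Set E) (x y : E) : ℝ :=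
  infDist y Γ * whitneyBump E ((infDist y Γ)⁻¹ • (x - y))

/-- The derivative of `whitneyKernel` in its first variable. -/
noncomputable def whitneyKernelDeriv (Γ : Set E) (x y : E) : E →L[ℝ] ℝ :=
  (infDist y Γ * (infDist y Γ)⁻¹) • fderiv ℝ (whitneyBump E) ((infDist y Γ)⁻¹ • (x - y))

lemma whitneyKernel_nonneg (Γ : Set E) (x y : E) : 0 ≤ whitneyKernel Γ x y :=
  mul_nonneg infDist_nonneg (whitneyBump E).nonneg

lemma whitneyKernel_le (Γ : Set E) (x y : E) : whitneyKernel Γ x y ≤ infDist y Γ :=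
  mul_le_of_le_one_right infDist_nonneg (whitneyBump E).le_one

lemma whitneyKernel_eq_zero {Γ : Set E} {x y : E} (h : infDist y Γ ≤ 4 * dist x y) :
    whitneyKernel Γ x y = 0 := by
  rcases (infDist_nonneg (x := y) (s := Γ)).eq_or_lt with h0 | h0
  · simp [whitneyKernel, ← h0]
  · refine mul_eq_zero_of_right _ ((whitneyBump E).zero_of_le_dist ?_)
    rw [dist_zero_right, norm_smul, norm_inv, Real.norm_of_nonneg h0.le, ← dist_eq_norm,
      inv_mul_eq_div, le_div_iff₀ h0]
    change 1 / 4 * _ ≤ _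
    linarith

lemma whitneyKernel_eq_infDist {Γ : Set E} {x y : E} (h : 8 * dist x y ≤ infDist y Γ) :
    whitneyKernel Γ x y = infDist y Γ := by
  rcases (infDist_nonneg (x := y) (s := Γ)).eq_or_lt with h0 | h0
  · simp [whitneyKernel, ← h0]
  · rw [whitneyKernel, (whitneyBump E).one_of_mem_closedBall, mul_one]
    rw [mem_closedBall, dist_zero_right, norm_smul, norm_inv, Real.norm_of_nonneg h0.le,
      ← dist_eq_norm, inv_mul_eq_div, div_le_iff₀ h0]
    change _ ≤ 1 / 8 * _
    linarith

lemma whitneyKernelDeriv_eq_zero {Γ : Set E} {x y : E} (h : infDist y Γ < 4 * dist x y) :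
    whitneyKernelDeriv Γ x y = 0 := by
  rcases (infDist_nonneg (x := y) (s := Γ)).eq_or_lt with h0 | h0
  · simp [whitneyKernelDeriv, ← h0]
  · rw [whitneyKernelDeriv]
    refine smul_eq_zero_of_right _ ?_
    by_contra hne
    have := support_fderiv_subset ℝ (Function.mem_support.2 hne)
    rw [(whitneyBump E).tsupport_eq, mem_closedBall, dist_zero_right, norm_smul, norm_inv,
      Real.norm_of_nonneg h0.le, ← dist_eq_norm, inv_mul_eq_div, div_le_iff₀ h0] at this
    change _ ≤ 1 / 4 * _ at this
    linarith

lemma hasFDerivAt_whitneyKernel (Γ : Set E) (x y : E) :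
    HasFDerivAt (fun x ↦ whitneyKernel Γ x y) (whitneyKernelDeriv Γ x y) x := by
  have hb : HasFDerivAt (whitneyBump E)
      (fderiv ℝ (whitneyBump E) ((infDist y Γ)⁻¹ • (x - y))) ((infDist y Γ)⁻¹ • (x - y)) :=
    (((whitneyBump E).contDiff (n := 1)).differentiable one_ne_zero _).hasFDerivAt
  have hl : HasFDerivAt (fun x ↦ (infDist y Γ)⁻¹ • (x - y))
      ((infDist y Γ)⁻¹ • ContinuousLinearMap.id ℝ E) x :=
    ((hasFDerivAt_id x).sub_const y).const_smul _
  refine ((hb.comp x hl).const_mul (infDist y Γ)).congr_fderiv ?_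
  ext v
  simp [whitneyKernelDeriv, mul_assoc]

variable (E) in
lemma exists_norm_whitneyKernelDeriv_le :
    ∃ C : ℝ, 0 ≤ C ∧ ∀ (Γ : Set E) (x y : E), ‖whitneyKernelDeriv Γ x y‖ ≤ C := by
  obtain ⟨C, hC⟩ := ((whitneyBump E).hasCompactSupport.fderiv ℝ).exists_bound_of_continuous
    (((whitneyBump E).contDiff (n := 1)).continuous_fderiv one_ne_zero)
  refine ⟨C, (norm_nonneg _).trans (hC 0), fun Γ x y ↦ ?_⟩
  rw [whitneyKernelDeriv, norm_smul]
  refine (mul_le_of_le_one_left (norm_nonneg _) ?_).trans (hC _)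
  rw [Real.norm_of_nonneg (mul_nonneg infDist_nonneg (inv_nonneg.2 infDist_nonneg))]
  exact mul_inv_le_one

variable {V : Type*} [NormedAddCommGroup V] [NormedSpace ℝ V]

lemma norm_whitneyKernel_smul_le {Γ : Set E} {x₀ y : E} {h : E → V} {S : ℝ}
    (hS : ∀ y ∈ closedBall x₀ (infDist x₀ Γ / 2), ‖h y‖ ≤ S)
    (hy : y ∈ closedBall x₀ (infDist x₀ Γ / 2)) :
    ‖whitneyKernel Γ x₀ y • h y‖ ≤ 2 * infDist x₀ Γ * S := by
  rw [norm_smul, Real.norm_of_nonneg (whitneyKernel_nonneg _ _ _)]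
  have h1 := infDist_le_infDist_add_dist (s := Γ) (x := y) (y := x₀)
  have h2 := whitneyKernel_le Γ x₀ y
  have h3 : 0 ≤ infDist x₀ Γ := infDist_nonneg
  have h4 := mem_closedBall.1 hy
  gcongr
  · linarith
  · exact hS y hy

variable [MeasurableSpace E] [BorelSpace E]

/-- The unnormalized average of `h` against `whitneyKernel`. -/
noncomputable def whitneyAverage (Γ : Set E) (h : E → V) (x : E) : V :=
  ∫ y, whitneyKernel Γ x y • h y

lemma measurable_whitneyKernel (Γ : Set E) (x : E) : Measurable (whitneyKernel Γ x) := by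
  have := (whitneyBump E).continuous.measurable
  have hd : Measurable fun y ↦ infDist y Γ := measurable_infDist
  exact hd.mul (this.comp (hd.inv.smul (measurable_const.sub measurable_id)))

lemma measurable_whitneyKernelDeriv (Γ : Set E) (x : E) : Measurable (whitneyKernelDeriv Γ x) := by
  have hb : Measurable (fderiv ℝ (whitneyBump E)) :=
    (((whitneyBump E).contDiff (n := 1)).continuous_fderiv one_ne_zero).measurable
  have hd : Measurable fun y ↦ infDist y Γ := measurable_infDist
  exact (hd.mul hd.inv).smul (hb.comp (hd.inv.smul (measurable_const.sub measurable_id)))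

lemma integrable_whitneyKernel_smul {Γ : Set E} {x₀ : E} (h0 : 0 < infDist x₀ Γ) {h : E → V}
    (hh : Continuous h) : Integrable fun y ↦ whitneyKernel Γ x₀ y • h y := by
  obtain ⟨S, hS⟩ := (isCompact_closedBall x₀ (infDist x₀ Γ / 2)).exists_bound_of_continuousOn
    hh.continuousOn
  have hsupp : Function.support (fun y ↦ whitneyKernel Γ x₀ y • h y) ⊆
      closedBall x₀ (infDist x₀ Γ / 2) := by
    intro y hy
    by_contra hy'
    refine hy ?_
    simp [whitneyKernel_eq_zero
      (infDist_lt_four_mul_dist (by rw [dist_self]; positivity) h0 hy').le]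
  rw [← integrableOn_iff_integrable_of_support_subset hsupp]
  refine Measure.integrableOn_of_bounded (M := 2 * infDist x₀ Γ * S)
    measure_closedBall_lt_top.ne
    ((measurable_whitneyKernel Γ x₀).aestronglyMeasurable.smul hh.aestronglyMeasurable) ?_
  filter_upwards [ae_restrict_mem measurableSet_closedBall] with y hy
  exact norm_whitneyKernel_smul_le hS hy

lemma norm_whitneyAverage_le {Γ : Set E} {x₀ : E} (h0 : 0 < infDist x₀ Γ) {h : E → V} {S : ℝ}
    (hS : ∀ y ∈ closedBall x₀ (infDist x₀ Γ / 2), ‖h y‖ ≤ S) :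
    ‖whitneyAverage Γ h x₀‖ ≤
      2 * infDist x₀ Γ * S * volume.real (closedBall x₀ (infDist x₀ Γ / 2)) := by
  rw [whitneyAverage, ← setIntegral_eq_integral_of_forall_compl_eq_zero
    (s := closedBall x₀ (infDist x₀ Γ / 2))]
  · exact norm_setIntegral_le_of_norm_le_const measure_closedBall_lt_top
      fun y hy ↦ norm_whitneyKernel_smul_le hS hy
  · intro y hy
    simp [whitneyKernel_eq_zero
      (infDist_lt_four_mul_dist (by rw [dist_self]; positivity) h0 hy).le]

lemma exists_hasFDerivAt_whitneyAverage {Γ : Set E} {x₀ : E} (h0 : 0 < infDist x₀ Γ) {h : E → V}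
    (hh : Continuous h) {C S : ℝ} (hC : ∀ x y, ‖whitneyKernelDeriv Γ x y‖ ≤ C)
    (hS : ∀ y ∈ closedBall x₀ (infDist x₀ Γ / 2), ‖h y‖ ≤ S) :
    ∃ A : E →L[ℝ] V, HasFDerivAt (whitneyAverage Γ h) A x₀ ∧
      ‖A‖ ≤ C * S * volume.real (closedBall x₀ (infDist x₀ Γ / 2)) := by
  have hC0 : 0 ≤ C := (norm_nonneg _).trans (hC x₀ x₀)
  have hzero : ∀ y ∉ closedBall x₀ (infDist x₀ Γ / 2), ∀ x ∈ ball x₀ (infDist x₀ Γ / 16),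
      whitneyKernelDeriv Γ x y = 0 := fun y hy x hx ↦
    whitneyKernelDeriv_eq_zero (infDist_lt_four_mul_dist (mem_ball.1 hx).le h0 hy)
  have hx₀ : x₀ ∈ ball x₀ (infDist x₀ Γ / 16) := mem_ball_self (by positivity)
  refine ⟨∫ y, (whitneyKernelDeriv Γ x₀ y).smulRight (h y), ?_, ?_⟩
  · refine hasFDerivAt_integral_of_dominated_of_fderiv_le
      (F' := fun x y ↦ (whitneyKernelDeriv Γ x y).smulRight (h y))
      (bound := (closedBall x₀ (infDist x₀ Γ / 2)).indicator fun _ ↦ C * S)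
      (isOpen_ball.mem_nhds hx₀) ?_ (integrable_whitneyKernel_smul h0 hh) ?_ ?_ ?_ ?_
    · exact .of_forall fun x ↦
        (measurable_whitneyKernel Γ x).aestronglyMeasurable.smul hh.aestronglyMeasurable
    · have := (ContinuousLinearMap.smulRightL ℝ E V).continuous₂
      exact this.comp_aestronglyMeasurable₂
        (measurable_whitneyKernelDeriv Γ x₀).aestronglyMeasurable hh.aestronglyMeasurable
    · refine .of_forall fun y x hx ↦ ?_
      by_cases hy : y ∈ closedBall x₀ (infDist x₀ Γ / 2)
      · rw [indicator_of_mem hy, ContinuousLinearMap.norm_smulRight_apply]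
        exact mul_le_mul (hC x y) (hS y hy) (norm_nonneg _) hC0
      · rw [indicator_of_notMem hy, hzero y hy x hx]
        simp
    · exact (integrable_indicator_iff measurableSet_closedBall).2
        (integrableOn_const measure_closedBall_lt_top.ne)
    · exact .of_forall fun y x _ ↦ (hasFDerivAt_whitneyKernel Γ x y).smul_const (h y)
  · rw [← setIntegral_eq_integral_of_forall_compl_eq_zero
      (s := closedBall x₀ (infDist x₀ Γ / 2))]
    · refine norm_setIntegral_le_of_norm_le_const measure_closedBall_lt_top fun y hy ↦ ?_
      rw [ContinuousLinearMap.norm_smulRight_apply]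
      exact mul_le_mul (hC x₀ y) (hS y hy) (norm_nonneg _) hC0
    · intro y hy
      rw [hzero y hy x₀ hx₀]
      simp

lemma le_whitneyAverage_one {Γ : Set E} {x₀ : E} (h0 : 0 < infDist x₀ Γ) :
    infDist x₀ Γ / 2 * volume.real (closedBall x₀ (infDist x₀ Γ / 16)) ≤
      whitneyAverage Γ (fun _ ↦ (1 : ℝ)) x₀ := by
  have hint := integrable_whitneyKernel_smul h0 (h := fun _ : E ↦ (1 : ℝ)) continuous_const
  refine (setIntegral_ge_of_const_le_real measurableSet_closedBall measure_closedBall_lt_top.ne ?_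
    hint.integrableOn).trans (setIntegral_le_integral hint (.of_forall fun y ↦ ?_))
  · intro y hy
    rw [mem_closedBall'] at hy
    have h1 := infDist_le_infDist_add_dist (s := Γ) (x := x₀) (y := y)
    rw [smul_eq_mul, mul_one, whitneyKernel_eq_infDist (by linarith)]
    linarith
  · simpa using whitneyKernel_nonneg Γ x₀ y

/-- The normalized average of `h` against `whitneyKernel`. -/
noncomputable def whitneyMean (Γ : Set E) (h : E → V) (x : E) : V :=
  (whitneyAverage Γ (fun _ ↦ (1 : ℝ)) x)⁻¹ • whitneyAverage Γ h x

lemma whitneyAverage_one_pos {Γ : Set E} {x : E} (h0 : 0 < infDist x Γ) :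
    0 < whitneyAverage Γ (fun _ ↦ (1 : ℝ)) x :=
  lt_of_lt_of_le (mul_pos (by positivity)
    (ENNReal.toReal_pos (measure_closedBall_pos volume x (by positivity)).ne'
      measure_closedBall_lt_top.ne)) (le_whitneyAverage_one h0)

lemma whitneyMean_eq_add [CompleteSpace V] {Γ : Set E} {x : E} (h0 : 0 < infDist x Γ) {h : E → V}
    (hh : Continuous h) (a : V) :
    whitneyMean Γ h x = a + whitneyMean Γ (fun y ↦ h y - a) x := by
  have hsub : whitneyAverage Γ (fun y ↦ h y - a) x =
      whitneyAverage Γ h x - whitneyAverage Γ (fun _ ↦ (1 : ℝ)) x • a := by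
    have hint := integrable_whitneyKernel_smul h0 (h := fun _ : E ↦ (1 : ℝ)) continuous_const
    simp only [whitneyAverage, smul_sub]
    rw [integral_sub (integrable_whitneyKernel_smul h0 hh)
      (integrable_whitneyKernel_smul h0 continuous_const), ← integral_smul_const]
    simp
  rw [whitneyMean, whitneyMean, hsub, smul_sub, inv_smul_smul₀ (whitneyAverage_one_pos h0).ne']
  abel

variable (E V) in
/-- `whitneyMean` is close to the original function, and its derivative is controlled by the local
oscillation of that function. -/
lemma exists_whitneyMean_bounds [CompleteSpace V] :
    ∃ K : ℝ, 0 ≤ K ∧ ∀ (Γ : Set E) (x₀ : E) (h : E → V) (S : ℝ), 0 < infDist x₀ Γ →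
      Continuous h → (∀ y ∈ closedBall x₀ (infDist x₀ Γ / 2), ‖h y - h x₀‖ ≤ S) →
      ‖whitneyMean Γ h x₀ - h x₀‖ ≤ K * S ∧ DifferentiableAt ℝ (whitneyMean Γ h) x₀ ∧
        ‖fderiv ℝ (whitneyMean Γ h) x₀‖ ≤ K * (S / infDist x₀ Γ) := by
  obtain ⟨C, hC0, hC⟩ := exists_norm_whitneyKernelDeriv_le E
  set n := Module.finrank ℝ E
  refine ⟨4 * 8 ^ n + 2 * C * 8 ^ n + 8 * C * (8 ^ n) ^ 2, by positivity, ?_⟩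
  intro Γ x₀ h S h0 hh hS
  have hS0 : 0 ≤ S := (norm_nonneg _).trans (hS x₀ (mem_closedBall_self (by positivity)))
  have hh' : Continuous fun y ↦ h y - h x₀ := hh.sub continuous_const
  obtain ⟨A, hA, hAn⟩ := exists_hasFDerivAt_whitneyAverage h0 hh' (hC Γ) hS
  obtain ⟨B, hB, hBn⟩ := exists_hasFDerivAt_whitneyAverage h0
    (h := fun _ : E ↦ (1 : ℝ)) continuous_const (hC Γ) (S := 1) (by simp)
  have hN := norm_whitneyAverage_le h0 hS
  have hD := le_whitneyAverage_one h0
  have hDpos := whitneyAverage_one_pos h0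
  set d := infDist x₀ Γ
  set N := whitneyAverage Γ (fun y ↦ h y - h x₀) x₀ with hN_def
  set D := whitneyAverage Γ (fun _ ↦ (1 : ℝ)) x₀ with hD_def
  set v := volume.real (closedBall x₀ (d / 16)) with hv_def
  have hv : 0 < v := ENNReal.toReal_pos (measure_closedBall_pos volume x₀ (by positivity)).ne'
    measure_closedBall_lt_top.ne
  have hvol : volume.real (closedBall x₀ (d / 2)) = 8 ^ n * v := by
    rw [hv_def, Measure.addHaar_real_closedBall _ _ (by positivity),
      Measure.addHaar_real_closedBall _ _ (by positivity), ← mul_assoc, ← mul_pow]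
    congr 2
    ring
  rw [hvol] at hAn hBn hN
  have hDinv : D⁻¹ ≤ (d / 2 * v)⁻¹ := inv_anti₀ (by positivity) hD
  have hDinv0 : 0 ≤ D⁻¹ := inv_nonneg.2 hDpos.le
  have hderiv : HasFDerivAt (whitneyMean Γ h)
      (D⁻¹ • A + (-(D ^ 2)⁻¹ • B).smulRight N) x₀ := by
    have h1 : HasFDerivAt (fun x ↦ (whitneyAverage Γ (fun _ ↦ (1 : ℝ)) x)⁻¹)
        (-(D ^ 2)⁻¹ • B) x₀ := (hasDerivAt_inv hDpos.ne').comp_hasFDerivAt x₀ hB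
    refine ((h1.smul hA).const_add (h x₀)).congr_of_eventuallyEq ?_
    have : ∀ᶠ x in 𝓝 x₀, 0 < infDist x Γ :=
      (continuous_infDist_pt Γ).continuousAt.eventually_const_lt h0
    filter_upwards [this] with x hx
    exact whitneyMean_eq_add hx hh (h x₀)
  refine ⟨?_, hderiv.differentiableAt, ?_⟩
  · rw [whitneyMean_eq_add h0 hh (h x₀), add_sub_cancel_left, whitneyMean, ← hN_def, ← hD_def,
      norm_smul, Real.norm_of_nonneg hDinv0]
    calc D⁻¹ * ‖N‖ ≤ (d / 2 * v)⁻¹ * (2 * d * S * (8 ^ n * v)) := by gcongr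
      _ = 4 * 8 ^ n * S := by field_simp; ring
      _ ≤ _ := by
        gcongr
        have : 0 ≤ 2 * C * 8 ^ n + 8 * C * (8 ^ n) ^ 2 := by positivity
        linarith
  · rw [hderiv.fderiv]
    have hsm : ‖-(D ^ 2)⁻¹ • B‖ = D⁻¹ ^ 2 * ‖B‖ := by
      rw [norm_smul, norm_neg, ← inv_pow, Real.norm_of_nonneg (by positivity)]
    calc ‖D⁻¹ • A + (-(D ^ 2)⁻¹ • B).smulRight N‖
        ≤ D⁻¹ * ‖A‖ + D⁻¹ ^ 2 * ‖B‖ * ‖N‖ := by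
          refine (norm_add_le _ _).trans ?_
          rw [norm_smul, ContinuousLinearMap.norm_smulRight_apply, hsm,
            Real.norm_of_nonneg hDinv0]
      _ ≤ (d / 2 * v)⁻¹ * (C * S * (8 ^ n * v)) +
          (d / 2 * v)⁻¹ ^ 2 * (C * 1 * (8 ^ n * v)) * (2 * d * S * (8 ^ n * v)) := by gcongr
      _ = (2 * C * 8 ^ n + 8 * C * (8 ^ n) ^ 2) * (S / d) := by field_simp; ring
      _ ≤ _ := by
        gcongr
        have : (0 : ℝ) ≤ 4 * 8 ^ n := by positivity
        linarith

/-- A Hölder continuous function can be smoothed off a closed set `Γ`, without changing it on `Γ`,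
keeping the Hölder continuity and with the natural bound on the derivative. -/
theorem exists_smoothing_off_closed [CompleteSpace V] {Γ : Set E} (hΓ : IsClosed Γ)
    (hne : Γ.Nonempty) {μ : ℝ} (hμ0 : 0 < μ) (hμ1 : μ ≤ 1) {g : E → V} {H : ℝ} (hH : 0 ≤ H)
    (hg : ∀ x y, ‖g x - g y‖ ≤ H * ‖x - y‖ ^ μ) :
    ∃ (G : E → V) (c M : ℝ), 0 ≤ c ∧ 0 ≤ M ∧ (∀ x ∈ Γ, G x = g x) ∧
      (∀ x y, ‖G x - G y‖ ≤ M * ‖x - y‖ ^ μ) ∧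
      ∀ x ∉ Γ, DifferentiableAt ℝ G x ∧ ‖fderiv ℝ G x‖ ≤ c * infDist x Γ ^ (μ - 1) := by
  classical
  obtain ⟨K, hK, hbd⟩ := exists_whitneyMean_bounds E V
  have hgc : Continuous g := by
    refine continuous_iff_continuousAt.2 fun x ↦ tendsto_iff_norm_sub_tendsto_zero.2 ?_
    refine squeeze_zero (fun y ↦ norm_nonneg _) (fun y ↦ hg y x) ?_
    have : Continuous fun y ↦ H * ‖y - x‖ ^ μ := by fun_prop (disch := positivity)
    simpa [Real.zero_rpow hμ0.ne'] using this.tendsto x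
  have hpos : ∀ x ∉ Γ, 0 < infDist x Γ := fun x hx ↦ (hΓ.notMem_iff_infDist_pos hne).1 hx
  have hosc : ∀ x ∉ Γ, ∀ y ∈ closedBall x (infDist x Γ / 2),
      ‖g y - g x‖ ≤ H * infDist x Γ ^ μ := by
    intro x hx y hy
    refine (hg y x).trans ?_
    have := hpos x hx
    rw [mem_closedBall, dist_eq_norm] at hy
    gcongr
    linarith
  set G : E → V := fun x ↦ if x ∈ Γ then g x else whitneyMean Γ g x
  have hGmem : ∀ x ∈ Γ, G x = g x := fun x hx ↦ if_pos hx
  have hGev : ∀ x ∉ Γ, G =ᶠ[𝓝 x] whitneyMean Γ g := fun x hx ↦ by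
    filter_upwards [hΓ.isOpen_compl.mem_nhds hx] with y hy
    exact if_neg hy
  have hGd : ∀ x ∉ Γ, DifferentiableAt ℝ G x ∧
      ‖fderiv ℝ G x‖ ≤ K * H * infDist x Γ ^ (μ - 1) := by
    intro x hx
    obtain ⟨-, h1, h2⟩ := hbd Γ x g _ (hpos x hx) hgc (hosc x hx)
    refine ⟨h1.congr_of_eventuallyEq (hGev x hx), ?_⟩
    rw [(hGev x hx).fderiv_eq, Real.rpow_sub_one (hpos x hx).ne', mul_assoc]
    simpa only [mul_div_assoc] using h2
  have hGg : ∀ x, ‖G x - g x‖ ≤ K * H * infDist x Γ ^ μ := by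
    intro x
    by_cases hx : x ∈ Γ
    · rw [hGmem x hx, sub_self, norm_zero]
      have : 0 ≤ infDist x Γ := infDist_nonneg
      positivity
    · rw [(hGev x hx).eq_of_nhds, mul_assoc]
      exact (hbd Γ x g _ (hpos x hx) hgc (hosc x hx)).1
  refine ⟨G, K * H, K * H * 2 ^ μ + H + K * H * 3 ^ μ + K * H, by positivity, by positivity,
    hGmem, fun x y ↦ ?_, hGd⟩
  have hxy0 : 0 ≤ ‖x - y‖ ^ μ := by positivity
  rcases le_or_gt (infDist x Γ) (2 * ‖x - y‖) with hfar | hnear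
  · have hy : infDist y Γ ≤ 3 * ‖x - y‖ := by
      have := infDist_le_infDist_add_dist (s := Γ) (x := y) (y := x)
      rw [dist_comm, dist_eq_norm] at this
      linarith
    have h1 : ‖G x - g x‖ ≤ K * H * 2 ^ μ * ‖x - y‖ ^ μ := by
      rw [mul_assoc _ (2 ^ μ), ← Real.mul_rpow (by norm_num) (norm_nonneg _)]
      refine (hGg x).trans ?_
      have : 0 ≤ infDist x Γ := infDist_nonneg
      gcongr
    have h2 : ‖G y - g y‖ ≤ K * H * 3 ^ μ * ‖x - y‖ ^ μ := by
      rw [mul_assoc _ (3 ^ μ), ← Real.mul_rpow (by norm_num) (norm_nonneg _)]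
      refine (hGg y).trans ?_
      have : 0 ≤ infDist y Γ := infDist_nonneg
      gcongr
    have h3 : 0 ≤ K * H * ‖x - y‖ ^ μ := by positivity
    calc ‖G x - G y‖ = ‖(G x - g x) + (g x - g y) - (G y - g y)‖ := by congr 1; abel
      _ ≤ ‖G x - g x‖ + ‖g x - g y‖ + ‖G y - g y‖ :=
        (norm_sub_le _ _).trans (by gcongr; exact norm_add_le _ _)
      _ ≤ _ := by linarith [hg x y]
  · rcases eq_or_ne x y with rfl | hne'
    · simp only [sub_self, norm_zero]
      positivity
    have hr : 0 < ‖x - y‖ := norm_pos_iff.2 (sub_ne_zero.2 hne')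
    have hball : ∀ z ∈ closedBall x ‖x - y‖, ‖x - y‖ ≤ infDist z Γ := by
      intro z hz
      have := infDist_le_infDist_add_dist (s := Γ) (x := x) (y := z)
      rw [mem_closedBall'] at hz
      linarith
    have hnot : ∀ z ∈ closedBall x ‖x - y‖, z ∉ Γ := fun z hz ↦
      (hΓ.notMem_iff_infDist_pos hne).2 (hr.trans_le (hball z hz))
    have := (convex_closedBall x ‖x - y‖).norm_image_sub_le_of_norm_fderiv_le (𝕜 := ℝ) (f := G)
      (C := K * H * ‖x - y‖ ^ (μ - 1)) (fun z hz ↦ (hGd z (hnot z hz)).1)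
      (fun z hz ↦ (hGd z (hnot z hz)).2.trans ?_)
      (x := y) (y := x) (by rw [mem_closedBall', dist_eq_norm]) (mem_closedBall_self hr.le)
    · refine this.trans ?_
      rw [mul_assoc, ← Real.rpow_add_one hr.ne', sub_add_cancel]
      have : 0 ≤ K * H * 2 ^ μ + H + K * H * 3 ^ μ := by positivity
      gcongr
      linarith
    · exact mul_le_mul_of_nonneg_left
        (Real.rpow_le_rpow_of_nonpos hr (hball z hz) (by linarith)) (by positivity)

end WhitneyAverage

/-- A Hölder continuous function on a subset, with values in a finite-dimensional space, extends to
a Hölder continuous function on the whole space. -/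
theorem exists_holder_extension {X V : Type*} [SeminormedAddCommGroup X] [NormedAddCommGroup V]
    [NormedSpace ℝ V] [FiniteDimensional ℝ V] {s : Set X} {μ : ℝ} (hμ0 : 0 < μ) (hμ1 : μ ≤ 1)
    {f : X → V} {M : ℝ} (hf : ∀ x ∈ s, ∀ y ∈ s, ‖f x - f y‖ ≤ M * ‖x - y‖ ^ μ) :
    ∃ (g : X → V) (H : ℝ), 0 ≤ H ∧ (∀ x y, ‖g x - g y‖ ≤ H * ‖x - y‖ ^ μ) ∧
      ∀ x ∈ s, g x = f x := by
  let φ : X ≃ Snowflaking X μ hμ0 hμ1 := Snowflaking.toSnowflaking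
  have hL : LipschitzOnWith M.toNNReal (f ∘ φ.symm) (φ.symm ⁻¹' s) := by
    refine LipschitzOnWith.of_dist_le_mul fun x hx y hy ↦ ?_
    obtain ⟨x, rfl⟩ := φ.surjective x
    obtain ⟨y, rfl⟩ := φ.surjective y
    rw [mem_preimage, φ.symm_apply_apply] at hx hy
    simp only [φ, Function.comp_apply, Equiv.symm_apply_apply,
      Snowflaking.dist_toSnowflaking_toSnowflaking]
    rw [dist_eq_norm, dist_eq_norm]
    refine (hf x hx y hy).trans ?_
    gcongr
    exact Real.le_coe_toNNReal M
  obtain ⟨g, hg, hgf⟩ := hL.extend_finite_dimension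
  refine ⟨g ∘ φ, (lipschitzExtensionConstant V * M.toNNReal : ℝ≥0), NNReal.coe_nonneg _,
    fun x y ↦ ?_, fun x hx ↦ ?_⟩
  · have := hg.dist_le_mul (φ x) (φ y)
    rwa [Snowflaking.dist_toSnowflaking_toSnowflaking, dist_eq_norm, dist_eq_norm] at this
  · simpa using (hgf (x := φ x) (by simpa using hx)).symm

/-- Whitney-type extension: if `Ω ⊂ ℝ³` is bounded open with boundary
`Γ = ∂Ω`, `0 < μ ≤ 1`, and `f : Γ → ℍ` is `μ`-Hölder continuous, then there are
`F : ℝ³ → ℍ` and constants `c, M > 0` such that: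
(a) `F = f` on `Γ`, `F = 0` off `Ω ∪ Γ`, and `F` is `μ`-Hölder (with constant `M`)
on `Ω ∪ Γ`;
(b) `F` is differentiable at every `x ∉ Γ` with `|∂F/∂xᵢ(x)| ≤ c·dist(x, Γ)^{μ−1}`. -/
theorem stmt13 (Ω : Set E3) (hΩo : IsOpen Ω) (hΩb : Bornology.IsBounded Ω)
    (μ : ℝ) (hμ0 : 0 < μ) (hμ1 : μ ≤ 1) (f : E3 → Quaternion ℝ)
    (hf : ∃ M₀ : ℝ, ∀ t ∈ frontier Ω, ∀ s ∈ frontier Ω,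
      ‖f t - f s‖ ≤ M₀ * ‖t - s‖ ^ μ) :
    ∃ (F : E3 → Quaternion ℝ) (c M : ℝ), 0 < c ∧ 0 < M ∧
      (∀ t ∈ frontier Ω, F t = f t) ∧
      (∀ x, x ∉ Ω ∪ frontier Ω → F x = 0) ∧
      (∀ x ∈ Ω ∪ frontier Ω, ∀ y ∈ Ω ∪ frontier Ω, ‖F x - F y‖ ≤ M * ‖x - y‖ ^ μ) ∧
      (∀ x, x ∉ frontier Ω → DifferentiableAt ℝ F x ∧
        ∀ i : Fin 3, ‖fderiv ℝ F x (EuclideanSpace.single i 1)‖ ≤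
          c * Metric.infDist x (frontier Ω) ^ (μ - 1)) := by
  rcases Ω.eq_empty_or_nonempty with rfl | hΩ
  · refine ⟨0, 1, 1, one_pos, one_pos, by simp, by simp, by simp,
      fun x _ ↦ ⟨by fun_prop, fun i ↦ ?_⟩⟩
    rw [show fderiv ℝ (0 : E3 → Quaternion ℝ) x = 0 from fderiv_const_apply 0]
    simpa using Real.rpow_nonneg (infDist_nonneg (x := x) (s := frontier (∅ : Set E3))) (μ - 1)
  have hne : (frontier Ω).Nonempty := by
    refine nonempty_frontier_iff.2 ⟨hΩ, fun h ↦ ?_⟩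
    exact NormedSpace.unbounded_univ ℝ E3 (h ▸ hΩb)
  obtain ⟨M₀, hM₀⟩ := hf
  obtain ⟨g, H, hH, hg, hgf⟩ := exists_holder_extension hμ0 hμ1 hM₀
  obtain ⟨G, c, M, hc, hM, hGg, hGH, hGd⟩ :=
    exists_smoothing_off_closed isClosed_frontier hne hμ0 hμ1 hH hg
  have hclosure : Ω ∪ frontier Ω = closure Ω := by
    rw [closure_eq_self_union_frontier]
  rw [hclosure]
  refine ⟨(closure Ω).indicator G, c + 1, M + 1, by positivity, by positivity, ?_, ?_, ?_, ?_⟩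
  · intro t ht
    rw [indicator_of_mem (frontier_subset_closure ht), hGg t ht, hgf t ht]
  · exact fun x hx ↦ indicator_of_notMem hx G
  · intro x hx y hy
    rw [indicator_of_mem hx, indicator_of_mem hy]
    refine (hGH x y).trans ?_
    gcongr
    linarith
  · intro x hx
    have hd : 0 ≤ infDist x (frontier Ω) ^ (μ - 1) := Real.rpow_nonneg infDist_nonneg _
    by_cases hxΩ : x ∈ Ω
    · have hev : (closure Ω).indicator G =ᶠ[𝓝 x] G := by
        filter_upwards [hΩo.mem_nhds hxΩ] with y hy
        exact indicator_of_mem (subset_closure hy) G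
      obtain ⟨h1, h2⟩ := hGd x hx
      refine ⟨h1.congr_of_eventuallyEq hev, fun i ↦ ?_⟩
      rw [hev.fderiv_eq]
      refine (ContinuousLinearMap.le_opNorm _ _).trans ?_
      rw [PiLp.norm_single, norm_one, mul_one]
      linarith
    · have hxc : x ∉ closure Ω := by
        rw [← hclosure]
        exact fun h ↦ h.elim hxΩ hx
      have hev : (closure Ω).indicator G =ᶠ[𝓝 x] fun _ ↦ 0 := by
        filter_upwards [isClosed_closure.isOpen_compl.mem_nhds hxc] with y hy
        exact indicator_of_notMem hy G
      refine ⟨(differentiableAt_const 0).congr_of_eventuallyEq hev, fun i ↦ ?_⟩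
      rw [hev.fderiv_eq, fderiv_const_apply, _root_.zero_apply, norm_zero]
      positivity
end
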